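/- Let R be a left noetherian ring and let GI(C) denote the class of Gorenstein injective complexes in Ch(R). Then the pair (⊥GI(C), GI(C)) is a complete hereditary cotorsion pair in Ch(R). -/

import Mathlib

open CategoryTheory CategoryTheory.Limits

universe u

section GenericDefs

variable {𝒜 : Type*} [Category 𝒜] [Abelian 𝒜]

/-- An object `G` of an abelian category is *Gorenstein injective* if it is a cycle object of
an exact (ℤ-indexed) complex of injective objects which stays exact under `Hom(I, -)` for
every injective object `I`. -/
def IsGorensteinInjective (G : 𝒜) : Prop :=
  ∃ C : ChainComplex 𝒜 ℤ,
    (∀ n, Injective (C.X n)) ∧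
    (∀ n, C.ExactAt n) ∧
    (∀ (I : 𝒜), Injective I → ∀ n,
      (((preadditiveCoyoneda.obj (Opposite.op I)).mapHomologicalComplex _).obj C).ExactAt n) ∧
    Nonempty (G ≅ kernel (C.d 0 (-1)))

/-- An object `G` is *Gorenstein projective* if it is a cycle object of an exact complex of
projectives which stays exact under `Hom(-, P)` for every projective `P`. -/
def IsGorensteinProjective (G : 𝒜) : Prop :=
  ∃ C : ChainComplex 𝒜 ℤ,
    (∀ n, Projective (C.X n)) ∧
    (∀ n, C.ExactAt n) ∧
    (∀ (P : 𝒜), Projective P → ∀ n,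
      (((preadditiveYoneda.obj P).mapHomologicalComplex _).obj C.op).ExactAt n) ∧
    Nonempty (G ≅ kernel (C.d 0 (-1)))

/-- `φ : G ⟶ X` is a `𝒞`-precover of `X`. -/
def IsPrecover (𝒞 : 𝒜 → Prop) {G X : 𝒜} (φ : G ⟶ X) : Prop :=
  𝒞 G ∧ ∀ (G' : 𝒜), 𝒞 G' → ∀ ψ : G' ⟶ X, ∃ h : G' ⟶ G, h ≫ φ = ψ

/-- `φ : G ⟶ X` is a `𝒞`-cover of `X`. -/
def IsCover (𝒞 : 𝒜 → Prop) {G X : 𝒜} (φ : G ⟶ X) : Prop :=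
  IsPrecover 𝒞 φ ∧ ∀ f : G ⟶ G, f ≫ φ = φ → IsIso f

/-- `φ : X ⟶ G` is a `𝒞`-preenvelope of `X`. -/
def IsPreenvelope (𝒞 : 𝒜 → Prop) {X G : 𝒜} (φ : X ⟶ G) : Prop :=
  𝒞 G ∧ ∀ (G' : 𝒜), 𝒞 G' → ∀ ψ : X ⟶ G', ∃ h : G ⟶ G', φ ≫ h = ψ

/-- `φ : X ⟶ G` is a `𝒞`-envelope of `X`. -/
def IsEnvelope (𝒞 : 𝒜 → Prop) {X G : 𝒜} (φ : X ⟶ G) : Prop :=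
  IsPreenvelope 𝒞 φ ∧ ∀ f : G ⟶ G, φ ≫ f = φ → IsIso f

/-- `Ext¹(X, Y) = 0`, expressed by the splitting of every extension of `X` by `Y`. -/
def Ext1Zero (X Y : 𝒜) : Prop :=
  ∀ (E : 𝒜) (i : Y ⟶ E) (p : E ⟶ X) (w : i ≫ p = 0),
    (ShortComplex.mk i p w).ShortExact → ∃ s : X ⟶ E, s ≫ p = 𝟙 X

/-- `ExtSucZero n X Y` says `Ext^(n+1)(X, Y) = 0`; defined by dimension shifting along
short exact sequences `0 ⟶ Y ⟶ E ⟶ Y' ⟶ 0` with `E` injective. -/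
def ExtSucZero : ℕ → 𝒜 → 𝒜 → Prop
  | 0, X, Y => Ext1Zero X Y
  | (n+1), X, Y => ∀ (E Y' : 𝒜) (i : Y ⟶ E) (p : E ⟶ Y') (w : i ≫ p = 0),
      (ShortComplex.mk i p w).ShortExact → Injective E → ExtSucZero n X Y'

/-- A special `𝒞`-precover: an epimorphism `φ : G ⟶ X` with `G ∈ 𝒞` arising in a short exact
sequence `0 ⟶ A ⟶ G ⟶ X ⟶ 0` with `Ext¹(G', A) = 0` for all `G' ∈ 𝒞`. -/
def IsSpecialPrecover (𝒞 : 𝒜 → Prop) {G X : 𝒜} (φ : G ⟶ X) : Prop :=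
  IsPrecover 𝒞 φ ∧ ∃ (A : 𝒜) (i : A ⟶ G) (w : i ≫ φ = 0),
    (ShortComplex.mk i φ w).ShortExact ∧ ∀ (G' : 𝒜), 𝒞 G' → Ext1Zero G' A

/-- The left `Ext¹`-orthogonal class `⊥𝒞` of a class of objects `𝒞`. -/
def leftOrthogonal {𝒜 : Type*} [Category 𝒜] [Abelian 𝒜] (𝒞 : 𝒜 → Prop) (X : 𝒜) : Prop :=
  ∀ Y : 𝒜, 𝒞 Y → Ext1Zero X Y

/-- The right `Ext¹`-orthogonal class `𝒞⊥` of a class of objects `𝒞`. -/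
def rightOrthogonal {𝒜 : Type*} [Category 𝒜] [Abelian 𝒜] (𝒞 : 𝒜 → Prop) (Y : 𝒜) : Prop :=
  ∀ X : 𝒜, 𝒞 X → Ext1Zero X Y

end GenericDefs

section Ext1

variable {𝒜 : Type*} [Category 𝒜] [Abelian 𝒜]

lemma shortExact_of_cokernel {X Y : 𝒜} (i : X ⟶ Y) [Mono i] :
    (ShortComplex.mk i (cokernel.π i) (cokernel.condition i)).ShortExact where
  exact := ShortComplex.exact_cokernel i

lemma shortExact_of_kernel {X Y : 𝒜} (p : X ⟶ Y) [Epi p] :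
    (ShortComplex.mk (kernel.ι p) p (kernel.condition p)).ShortExact where
  exact := ShortComplex.exact_kernel p

lemma Ext1Zero.exists_lift {S : ShortComplex 𝒜} (hS : S.ShortExact) {X : 𝒜}
    (h : Ext1Zero X S.X₁) (f : X ⟶ S.X₃) : ∃ g : X ⟶ S.X₂, g ≫ S.g = f := by
  have := hS.mono_f
  have := hS.epi_g
  let i : S.X₁ ⟶ pullback S.g f := pullback.lift S.f 0 (by simp)
  have hi : i ≫ pullback.fst _ _ = S.f := pullback.lift_fst _ _ _
  have hi' : i ≫ pullback.snd _ _ = 0 := pullback.lift_snd _ _ _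
  have : Mono i := by
    have : Mono (i ≫ pullback.fst _ _) := by rw [hi]; infer_instance
    exact mono_of_mono i (pullback.fst _ _)
  obtain ⟨s, hs⟩ := h _ i (pullback.snd S.g f) hi' <| by
    refine ShortComplex.ShortExact.mk' ?_ inferInstance inferInstance
    apply ShortComplex.exact_of_f_is_kernel
    refine KernelFork.IsLimit.ofι' _ _ fun {A} k hk ↦ ⟨hS.exact.lift (k ≫ pullback.fst _ _) ?_, ?_⟩
    · rw [Category.assoc, pullback.condition, reassoc_of% hk, zero_comp]
    · apply pullback.hom_ext
      · rw [Category.assoc, hi, hS.exact.lift_f]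
      · rw [Category.assoc, hi', comp_zero, hk]
  exact ⟨s ≫ pullback.fst _ _, by rw [Category.assoc, pullback.condition, reassoc_of% hs]⟩

lemma ext1Zero_iff_exists_lift {S : ShortComplex 𝒜} (hS : S.ShortExact) (hI : Injective S.X₂)
    {X : 𝒜} : Ext1Zero X S.X₁ ↔ ∀ f : X ⟶ S.X₃, ∃ g : X ⟶ S.X₂, g ≫ S.g = f := by
  refine ⟨fun h f ↦ h.exists_lift hS f, fun h F i p w hF ↦ ?_⟩
  have := hS.mono_f
  have : Mono i := hF.mono_f
  have : Epi p := hF.epi_g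
  let e : F ⟶ S.X₂ := Injective.factorThru S.f i
  have he : i ≫ e = S.f := Injective.comp_factorThru _ _
  obtain ⟨g, hg⟩ := h (hF.exact.desc (e ≫ S.g) (by simp [reassoc_of% he]))
  have hd : p ≫ g ≫ S.g = e ≫ S.g := by
    rw [hg]; exact hF.exact.g_desc _ _
  let r : F ⟶ S.X₁ := hS.exact.lift (e - p ≫ g) (by simp [hd])
  have hr : r ≫ S.f = e - p ≫ g := hS.exact.lift_f _ _
  have hir : i ≫ r = 𝟙 _ := by
    rw [← cancel_mono S.f]
    simp [hr, he, reassoc_of% w]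
  let s := hF.exact.desc (𝟙 F - r ≫ i) (by simp [reassoc_of% hir])
  have hs : p ≫ s = 𝟙 F - r ≫ i := hF.exact.g_desc _ _
  refine ⟨s, ?_⟩
  rw [← cancel_epi p, reassoc_of% hs]
  simp [w]

lemma Ext1Zero.of_iso {X Y Y' : 𝒜} (e : Y ≅ Y') (h : Ext1Zero X Y) : Ext1Zero X Y' := by
  intro F i p w hF
  refine h F (e.hom ≫ i) p (by simp [w]) (ShortComplex.shortExact_of_iso ?_ hF)
  exact ShortComplex.isoMk e.symm (Iso.refl _) (Iso.refl _) (by simp) (by simp)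

variable [EnoughInjectives 𝒜]

lemma Ext1Zero.exists_extend {S : ShortComplex 𝒜} (hS : S.ShortExact) {Y : 𝒜}
    (h : Ext1Zero S.X₃ Y) (f : S.X₁ ⟶ Y) : ∃ g : S.X₂ ⟶ Y, S.f ≫ g = f := by
  have := hS.mono_f
  have hY := shortExact_of_cokernel (Injective.ι Y)
  let e : S.X₂ ⟶ Injective.under Y := Injective.factorThru (f ≫ Injective.ι Y) S.f
  have he : S.f ≫ e = f ≫ Injective.ι Y := Injective.comp_factorThru _ _
  have := hS.epi_g
  let q := hS.exact.desc (e ≫ cokernel.π (Injective.ι Y)) (by simp [reassoc_of% he])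
  have hq : S.g ≫ q = e ≫ cokernel.π _ := hS.exact.g_desc _ _
  obtain ⟨g, hg⟩ := h.exists_lift hY q
  dsimp at hg
  refine ⟨hY.exact.lift (e - S.g ≫ g) (by simp [hg, hq]), ?_⟩
  have := hY.exact.lift_f (e - S.g ≫ g) (by simp [hg, hq])
  dsimp at this
  rw [← cancel_mono (Injective.ι Y), Category.assoc, this]
  simp [he]

lemma ext1Zero_of_exists_extend {S : ShortComplex 𝒜} (hS : S.ShortExact) (hP : Projective S.X₂)
    {Y : 𝒜} (h : ∀ f : S.X₁ ⟶ Y, ∃ g : S.X₂ ⟶ Y, S.f ≫ g = f) : Ext1Zero S.X₃ Y := by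
  have hY := shortExact_of_cokernel (Injective.ι Y)
  rw [ext1Zero_iff_exists_lift hY (by dsimp; infer_instance)]
  intro f
  have := hS.epi_g
  have := hY.epi_g
  dsimp at f
  let k : S.X₂ ⟶ Injective.under Y := Projective.factorThru (S.g ≫ f) (cokernel.π _)
  have hk : k ≫ cokernel.π _ = S.g ≫ f := Projective.factorThru_comp _ _
  obtain ⟨g, hg⟩ := h (hY.exact.lift (S.f ≫ k) (by simp [hk]))
  have hl := hY.exact.lift_f (S.f ≫ k) (by simp [hk])
  dsimp at hl
  let r := hS.exact.desc (k - g ≫ Injective.ι Y) (by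
    rw [Preadditive.comp_sub, reassoc_of% hg, hl, sub_self])
  have hr : S.g ≫ r = k - g ≫ Injective.ι Y := hS.exact.g_desc _ _
  refine ⟨r, ?_⟩
  rw [← cancel_epi S.g, reassoc_of% hr]
  simp [hk]

end Ext1

section SmallObject

variable {𝒜 : Type*} [Category.{u} 𝒜] [Abelian 𝒜] [IsGrothendieckAbelian.{u} 𝒜]

open MorphismProperty IsGrothendieckAbelian in
lemma hasSmallObjectArgument_ofHoms_of_mono {ι : Type u} {A B : ι → 𝒜} (k : ∀ i, A i ⟶ B i)
    [∀ i, Mono (k i)] : HasSmallObjectArgument.{u} (ofHoms k) := by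
  have hle : ofHoms k ≤ monomorphisms 𝒜 := by
    rw [ofHoms_le_iff]
    exact fun i ↦ inferInstanceAs (Mono (k i))
  obtain ⟨κ, hκ', hκ⟩ := HasCardinalLT.exists_regular_cardinal.{u} (Σ i, Subobject (A i))
  have : Fact κ.IsRegular := ⟨hκ'⟩
  have : Nonempty κ.ord.ToType := by simpa using hκ'.ne_zero
  have := WellFoundedLT.toOrderBot κ.ord.ToType
  exact ⟨κ, inferInstance, inferInstance,
    { preservesColimit {A' B X Y} i hi f hf := by
        let hf' : (monomorphisms 𝒜).TransfiniteCompositionOfShape κ.ord.ToType f :=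
          { toTransfiniteCompositionOfShape := hf.toTransfiniteCompositionOfShape
            map_mem j hj := by
              have := (hf.attachCells j hj).pushouts_coproducts
              simp only [ofHoms_homFamily] at this
              refine (?_ : _ ≤ monomorphisms 𝒜) _ this
              simp only [pushouts_le_iff, coproducts_le_iff]
              exact hle }
        have (j j' : κ.ord.ToType) (φ : j ⟶ j') : Mono (hf'.F.map φ) := hf'.mem_map φ
        apply preservesColimit_coyoneda_obj_of_mono (Y := hf'.F) (κ := κ)
        obtain ⟨i⟩ := hi
        exact hκ.of_injective (fun S ↦ ⟨i, S⟩) (fun _ _ h ↦ by simpa using h) }⟩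

/-- A morphism has the right lifting property against a monomorphism with projective target when
it is an epimorphism whose kernel is `Ext¹`-orthogonal to the cokernel of the monomorphism. -/
lemma hasLiftingProperty_of_ext1Zero {𝒜 : Type*} [Category 𝒜] [Abelian 𝒜] [EnoughInjectives 𝒜]
    {S T : ShortComplex 𝒜} (hS : S.ShortExact)
    (hP : Projective S.X₂) (hT : T.ShortExact) (h : Ext1Zero S.X₃ T.X₁) :
    HasLiftingProperty S.f T.g where
  sq_hasLift {a b} sq := by
    have := hT.epi_g
    have := hT.mono_f
    let l := Projective.factorThru b T.g
    have hl : l ≫ T.g = b := Projective.factorThru_comp _ _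
    obtain ⟨g, hg⟩ := h.exists_extend hS (hT.exact.lift (a - S.f ≫ l) (by simp [hl, sq.w]))
    have hl' := hT.exact.lift_f (a - S.f ≫ l) (by simp [hl, sq.w])
    exact ⟨⟨⟨g ≫ T.f + l, by simp [reassoc_of% hg, hl'], by simp [hl]⟩⟩⟩

lemma epi_of_lift_separator [EnoughProjectives 𝒜] {Y Z : 𝒜} (p : Y ⟶ Z)
    (h : ∀ f : Projective.over (separator 𝒜) ⟶ Z, ∃ g, g ≫ p = f) : Epi p := by
  refine ⟨fun a b hab ↦ ?_⟩
  refine (isSeparator_def _).1 (isSeparator_separator 𝒜) _ _ fun f ↦ ?_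
  rw [← cancel_epi (Projective.π (separator 𝒜))]
  obtain ⟨g, hg⟩ := h (Projective.π (separator 𝒜) ≫ f)
  rw [← reassoc_of% hg, ← reassoc_of% hg, hab]

open MorphismProperty ZeroObject in
/-- A small family of objects generates a complete cotorsion pair: one kind of approximation. -/
lemma exists_shortExact_leftOrthogonal [EnoughProjectives 𝒜] {κ : Type u} (t : κ → 𝒜) :
    ∀ X : 𝒜, (∃ S : ShortComplex 𝒜, S.ShortExact ∧ S.X₃ = X ∧
        leftOrthogonal (fun Y ↦ ∀ k, Ext1Zero (t k) Y) S.X₂ ∧ ∀ k, Ext1Zero (t k) S.X₁) ∧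
      (∃ S : ShortComplex 𝒜, S.ShortExact ∧ S.X₁ = X ∧
        (∀ k, Ext1Zero (t k) S.X₂) ∧ leftOrthogonal (fun Y ↦ ∀ k, Ext1Zero (t k) Y) S.X₃) := by
  intro X
  let P : 𝒜 := Projective.over (separator 𝒜)
  let S' (k : κ) : ShortComplex 𝒜 :=
    .mk (kernel.ι (Projective.π (t k))) (Projective.π (t k)) (kernel.condition _)
  have hS' (k : κ) : (S' k).ShortExact := shortExact_of_kernel _
  let A : Option κ → 𝒜 := fun k ↦ k.elim 0 (fun k ↦ (S' k).X₁)
  let B : Option κ → 𝒜 := fun k ↦ k.elim P (fun k ↦ (S' k).X₂)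
  let j : ∀ k, A k ⟶ B k := fun k ↦ match k with
    | none => 0
    | some k => (S' k).f
  have hj : ∀ k, Mono (j k) := fun k ↦ match k with
    | none => inferInstanceAs (Mono (0 : (0 : 𝒜) ⟶ P))
    | some k => (hS' k).mono_f
  have := hasSmallObjectArgument_ofHoms_of_mono j
  have rlp_of {T : ShortComplex 𝒜} (hT : T.ShortExact) (h : ∀ k, Ext1Zero (t k) T.X₁) :
      (ofHoms j).rlp T.g := by
    rintro _ _ _ ⟨_ | k⟩
    · have := hT.epi_g
      have : Projective (B none) := inferInstanceAs (Projective (Projective.over _))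
      constructor
      intro a b sq
      refine ⟨⟨⟨Projective.factorThru b T.g, ?_, Projective.factorThru_comp _ _⟩⟩⟩
      exact (isZero_zero 𝒜).eq_of_src _ _
    · exact hasLiftingProperty_of_ext1Zero (hS' k) (inferInstanceAs (Projective (Projective.over _)))
        hT (h k)
  have epi_of {Y Z : 𝒜} (p : Y ⟶ Z) (h : (ofHoms j).rlp p) : Epi p := by
    refine epi_of_lift_separator p fun f ↦ ?_
    have : HasLiftingProperty (0 : (0 : 𝒜) ⟶ P) p := h _ (ofHoms.mk none)
    have sq : CommSq (0 : (0 : 𝒜) ⟶ Y) (0 : (0 : 𝒜) ⟶ P) p f :=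
      ⟨(isZero_zero 𝒜).eq_of_src _ _⟩
    exact ⟨sq.lift, sq.fac_right⟩
  have ext_of {T : ShortComplex 𝒜} (hT : T.ShortExact) (h : (ofHoms j).rlp T.g) (k : κ) :
      Ext1Zero (t k) T.X₁ := by
    refine ext1Zero_of_exists_extend (hS' k) (inferInstanceAs (Projective (Projective.over _)))
      fun f ↦ ?_
    have : HasLiftingProperty (S' k).f T.g := h _ (ofHoms.mk (some k))
    have := hT.mono_f
    have sq : CommSq (f ≫ T.f) (S' k).f T.g 0 := ⟨by simp⟩
    have h1 : sq.lift ≫ T.g = 0 := sq.fac_right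
    have h2 : (S' k).f ≫ sq.lift = f ≫ T.f := sq.fac_left
    refine ⟨hT.exact.lift sq.lift h1, ?_⟩
    rw [← cancel_mono T.f, Category.assoc, hT.exact.lift_f]
    exact h2
  constructor
  · let fac := (functorialFactorizationData (ofHoms j).rlp.llp (ofHoms j).rlp).factorizationData
      (0 : 0 ⟶ X)
    have := epi_of _ fac.hp
    refine ⟨_, shortExact_of_kernel fac.p, rfl, fun Y hY F i p w hF ↦ ?_,
      ext_of (shortExact_of_kernel fac.p) fac.hp⟩
    have := fac.hi _ (rlp_of hF hY)
    have sq : CommSq 0 fac.i p (𝟙 fac.Z) := ⟨(isZero_zero 𝒜).eq_of_src _ _⟩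
    exact ⟨sq.lift, sq.fac_right⟩
  · let fac := (functorialFactorizationData (ofHoms j).rlp.llp (ofHoms j).rlp).factorizationData
      (0 : X ⟶ 0)
    have hmono : Mono fac.i := by
      have : HasLiftingProperty fac.i (0 : Injective.under X ⟶ 0) := by
        apply fac.hi
        rintro _ _ _ ⟨k⟩
        constructor
        intro a b sq
        exact ⟨⟨⟨Injective.factorThru a (j k), by simp, (isZero_zero 𝒜).eq_of_tgt _ _⟩⟩⟩
      have sq : CommSq (Injective.ι X) fac.i (0 : Injective.under X ⟶ 0) 0 := ⟨by simp⟩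
      have : Mono (fac.i ≫ sq.lift) := by rw [sq.fac_left]; infer_instance
      exact mono_of_mono fac.i sq.lift
    refine ⟨_, shortExact_of_cokernel fac.i, rfl, fun k ↦ ?_, fun Y hY F i p w hF ↦ ?_⟩
    · have hz : (ShortComplex.mk (𝟙 fac.Z) fac.p ((isZero_zero 𝒜).eq_of_tgt _ _)).ShortExact :=
        { exact := ShortComplex.exact_of_f_is_kernel _
            (KernelFork.IsLimit.ofι' _ _ fun l _ ↦ ⟨l, by simp⟩)
          epi_g := ⟨fun _ _ _ ↦ (isZero_zero 𝒜).eq_of_src _ _⟩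
          mono_f := inferInstanceAs (Mono (𝟙 fac.Z)) }
      exact ext_of hz fac.hp k
    · have := fac.hi _ (rlp_of hF hY)
      have sq : CommSq 0 fac.i p (cokernel.π fac.i) := ⟨by simp⟩
      refine ⟨cokernel.desc fac.i sq.lift sq.fac_left, ?_⟩
      rw [← cancel_epi (cokernel.π fac.i), cokernel.π_desc_assoc, sq.fac_right]
      simp

end SmallObject

section HomExact

variable {𝒜 : Type*} [Category 𝒜] [Abelian 𝒜]

/-- The complex `Hom(N, C)` is exact, in terms of elements. -/
def HomExact (N : 𝒜) (C : ChainComplex 𝒜 ℤ) : Prop :=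
  ∀ i j k : ℤ, j + 1 = i → k + 1 = j → ∀ f : N ⟶ C.X j, f ≫ C.d j k = 0 →
    ∃ g : N ⟶ C.X i, g ≫ C.d i j = f

lemma homExact_iff (N : 𝒜) (C : ChainComplex 𝒜 ℤ) :
    (∀ n, (((preadditiveCoyoneda.obj (Opposite.op N)).mapHomologicalComplex _).obj C).ExactAt n) ↔
      HomExact N C := by
  constructor
  · rintro h i j k rfl rfl
    have := (HomologicalComplex.exactAt_iff' _ (k + 1 + 1) (k + 1) k (by simp) (by simp)).1
      (h (k + 1))
    rw [ShortComplex.ab_exact_iff] at this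
    exact this
  · intro h n
    rw [HomologicalComplex.exactAt_iff' _ (n + 1) n (n - 1) (by simp) (by simp),
      ShortComplex.ab_exact_iff]
    exact h _ _ _ rfl (by simp)

variable {C : ChainComplex 𝒜 ℤ}

lemma exact_sc' (hC : ∀ n, C.ExactAt n) {i j k : ℤ} (hi : j + 1 = i) (hk : k + 1 = j) :
    (C.sc' i j k).Exact :=
  (HomologicalComplex.exactAt_iff' _ _ _ _ (by simp [hi]) (by simp [← hk])).1 (hC j)

lemma homExact_of_projective {P : 𝒜} (hP : Projective P) (hC : ∀ n, C.ExactAt n) :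
    HomExact P C := fun i j k hi hk f hf ↦ by
  have := exact_sc' hC hi hk
  exact ⟨this.liftFromProjective f hf, this.liftFromProjective_comp f hf⟩

lemma HomExact.left {S : ShortComplex 𝒜} (hS : S.ShortExact) (hI : ∀ n, Injective (C.X n))
    (h₂ : HomExact S.X₂ C) (h₃ : HomExact S.X₃ C) : HomExact S.X₁ C := by
  intro i j k hi hk f hf
  have := hS.mono_f
  have := hS.epi_g
  obtain ⟨h, hh⟩ : ∃ h : S.X₂ ⟶ C.X j, S.f ≫ h = f := ⟨_, Injective.comp_factorThru f S.f⟩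
  obtain ⟨q, hq⟩ : ∃ q : S.X₃ ⟶ C.X k, S.g ≫ q = h ≫ C.d j k :=
    ⟨_, hS.exact.g_desc (h ≫ C.d j k) (by rw [reassoc_of% hh, hf])⟩
  obtain ⟨r, hr⟩ := h₃ j k (k - 1) hk (by simp) q
    (by rw [← cancel_epi S.g, reassoc_of% hq]; simp)
  obtain ⟨l, hl⟩ := h₂ i j k hi hk (h - S.g ≫ r) (by simp [hr, hq])
  exact ⟨S.f ≫ l, by simp [hl, hh]⟩

lemma HomExact.right {S : ShortComplex 𝒜} (hS : S.ShortExact) (hI : ∀ n, Injective (C.X n))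
    (h₁ : HomExact S.X₁ C) (h₂ : HomExact S.X₂ C) : HomExact S.X₃ C := by
  intro i j k hi hk f hf
  have := hS.mono_f
  have := hS.epi_g
  obtain ⟨l, hl⟩ := h₂ i j k hi hk (S.g ≫ f) (by simp [hf])
  obtain ⟨p, hp⟩ := h₁ (i + 1) i j rfl hi (S.f ≫ l) (by simp [hl])
  obtain ⟨m, hm⟩ : ∃ m : S.X₂ ⟶ C.X (i + 1), S.f ≫ m = p :=
    ⟨_, Injective.comp_factorThru p S.f⟩
  obtain ⟨r, hr⟩ : ∃ r : S.X₃ ⟶ C.X i, S.g ≫ r = l - m ≫ C.d _ _ :=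
    ⟨_, hS.exact.g_desc (l - m ≫ C.d (i + 1) i) (by simp [reassoc_of% hm, hp])⟩
  exact ⟨r, by rw [← cancel_epi S.g, reassoc_of% hr]; simp [hl]⟩

/-- The short exact sequence expressing the cycles in degree `j` of an exact complex as the
quotient of the term in degree `i` by the cycles in degree `i`. -/
lemma shortExact_kernel_d (hC : ∀ n, C.ExactAt n) {i j k : ℤ} (hi : j + 1 = i) (hk : k + 1 = j) :
    (ShortComplex.mk (kernel.ι (C.d i j)) (kernel.lift (C.d j k) (C.d i j) (by simp))
      (by simp [← cancel_mono (kernel.ι (C.d j k))])).ShortExact := by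
  have := (exact_sc' hC hi hk).epi_kernelLift
  refine ShortComplex.ShortExact.mk' ?_ (by dsimp; infer_instance) this
  apply ShortComplex.exact_of_f_is_kernel
  refine KernelFork.IsLimit.ofι' _ _ fun l hl ↦ ⟨kernel.lift _ l ?_, kernel.lift_ι _ _ _⟩
  simpa using congrArg (· ≫ kernel.ι (C.d j k)) hl

lemma HomExact.ext1Zero {N : 𝒜} (hI : ∀ n, Injective (C.X n)) (hC : ∀ n, C.ExactAt n)
    (h : HomExact N C) {i j : ℤ} (hi : j + 1 = i) : Ext1Zero N (kernel (C.d i j)) := by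
  have hk : j - 1 + 1 = j := by simp
  rw [ext1Zero_iff_exists_lift (shortExact_kernel_d hC hi hk) (hI i)]
  intro f
  obtain ⟨g, hg⟩ := h i j _ hi hk (f ≫ kernel.ι _) (by simp)
  exact ⟨g, by simp [← cancel_mono (kernel.ι (C.d j (j - 1))), hg]⟩

end HomExact

section Resolution

variable {𝒜 : Type*} [Category 𝒜] [Abelian 𝒜]

lemma exists_int_sequence {α : Type*} {R : α → α → Prop} (h₁ : ∀ a, ∃ b, R b a)
    (h₂ : ∀ a, ∃ b, R a b) (a : α) : ∃ g : ℤ → α, g 1 = a ∧ ∀ n, R (g (n + 1)) (g n) := by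
  choose u hu using h₁
  choose v hv using h₂
  let g : ℤ → α := fun n ↦ match n with
    | .ofNat n => u^[n] a
    | .negSucc n => v^[n + 1] a
  have hg : ∀ n, R (g (n + 1)) (g n)
    | .ofNat n => by
      change R (u^[n + 1] a) (u^[n] a)
      rw [Function.iterate_succ_apply']
      exact hu _
    | .negSucc 0 => hv a
    | .negSucc (n + 1) => by
      change R (v^[n + 1] a) (v^[n + 1 + 1] a)
      rw [Function.iterate_succ_apply' _ (n + 1)]
      exact hv _
  exact ⟨fun n ↦ g (n - 1), rfl, fun n ↦ by simpa using hg (n - 1)⟩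

lemma ext1Zero_of_projective {P Y : 𝒜} (hP : Projective P) : Ext1Zero P Y := by
  intro E i p w hE
  have : Epi p := hE.epi_g
  exact ⟨_, Projective.factorThru_comp (𝟙 P) p⟩

lemma exactAt_of_homExact [EnoughProjectives 𝒜] {C : ChainComplex 𝒜 ℤ}
    (h : ∀ P, Projective P → HomExact P C) (n : ℤ) : C.ExactAt n := by
  rw [HomologicalComplex.exactAt_iff' _ (n + 1) n (n - 1) (by simp) (by simp),
    ShortComplex.exact_iff_exact_up_to_refinements]
  intro A (x : A ⟶ C.X n) (hx : x ≫ C.d n (n - 1) = 0)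
  obtain ⟨y, hy⟩ := h (Projective.over A) inferInstance (n + 1) n (n - 1) rfl (by simp)
    (Projective.π A ≫ x) (by rw [Category.assoc, hx, comp_zero])
  exact ⟨_, Projective.π A, inferInstance, y, hy.symm⟩

lemma IsGorensteinInjective.ext1Zero {G N : 𝒜} (hG : IsGorensteinInjective G)
    (hN : ∀ C : ChainComplex 𝒜 ℤ, (∀ n, Injective (C.X n)) → (∀ n, C.ExactAt n) →
      (∀ I, Injective I → HomExact I C) → HomExact N C) : Ext1Zero N G := by
  obtain ⟨C, hI, hC, hH, ⟨e⟩⟩ := hG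
  exact ((hN C hI hC fun I hI ↦ (homExact_iff I C).1 (hH I hI)).ext1Zero hI hC
    (i := 0) (j := -1) (by simp)).of_iso e.symm

/-- A class of objects is contained in the Gorenstein injectives if every member has an injective
precover and an injective cosyzygy within the class, and is orthogonal to the injectives. -/
lemma isGorensteinInjective_of_class [EnoughProjectives 𝒜] {𝒢 : 𝒜 → Prop}
    (hleft : ∀ G, 𝒢 G → ∃ S : ShortComplex 𝒜, S.ShortExact ∧ Injective S.X₂ ∧ 𝒢 S.X₁ ∧ S.X₃ = G)
    (hright : ∀ G, 𝒢 G → ∃ S : ShortComplex 𝒜, S.ShortExact ∧ Injective S.X₂ ∧ 𝒢 S.X₃ ∧ S.X₁ = G)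
    (hinj : ∀ G, 𝒢 G → ∀ I, Injective I → Ext1Zero I G) {G : 𝒜} (hG : 𝒢 G) :
    IsGorensteinInjective G := by
  let R : {G // 𝒢 G} → {G // 𝒢 G} → Prop := fun G' G ↦
    ∃ (E : 𝒜) (i : G'.1 ⟶ E) (p : E ⟶ G.1) (w : i ≫ p = 0),
      (ShortComplex.mk i p w).ShortExact ∧ Injective E
  obtain ⟨g, hg, hR⟩ := exists_int_sequence (R := R)
    (by
      rintro ⟨_, h⟩
      obtain ⟨S, hS, hI, hG, rfl⟩ := hleft _ h
      exact ⟨⟨_, hG⟩, _, S.f, S.g, S.zero, hS, hI⟩)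
    (by
      rintro ⟨_, h⟩
      obtain ⟨S, hS, hI, hG, rfl⟩ := hright _ h
      exact ⟨⟨_, hG⟩, _, S.f, S.g, S.zero, hS, hI⟩) ⟨G, hG⟩
  obtain rfl : (g 1).1 = G := by rw [hg]
  choose E i p w hE hI using hR
  have hmono n : Mono (i n) := (hE n).mono_f
  let C : ChainComplex 𝒜 ℤ := ChainComplex.of E (fun n ↦ p (n + 1) ≫ i n) (fun n ↦ by
    rw [Category.assoc, reassoc_of% (w (n + 1)), zero_comp, comp_zero])
  have hd n : C.d (n + 1) n = p (n + 1) ≫ i n := ChainComplex.of_d E (fun n ↦ p (n + 1) ≫ i n) n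
  have hom (N : 𝒜) (hN : ∀ n, Ext1Zero N (g n).1) : HomExact N C := by
    rintro _ _ k rfl rfl f hf
    have hf' : f ≫ p (k + 1) = 0 := by
      rw [hd, ← Category.assoc] at hf
      exact zero_of_comp_mono _ hf
    obtain ⟨l, hl⟩ : ∃ l, l ≫ i (k + 1) = f := ⟨_, (hE (k + 1)).exact.lift_f f hf'⟩
    obtain ⟨m, hm⟩ := (hN _).exists_lift (hE (k + 1 + 1)) l
    dsimp at hm
    exact ⟨m, by rw [hd, reassoc_of% hm, hl]⟩
  refine ⟨C, hI, exactAt_of_homExact fun P hP ↦ hom P fun n ↦ ext1Zero_of_projective hP,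
    fun I hI ↦ (homExact_iff I C).2 (hom I fun n ↦ hinj _ (g n).2 I hI), ?_⟩
  have key : ∀ m n, n + 1 = m → Nonempty ((g (m + 1)).1 ≅ kernel (C.d m n)) := by
    rintro _ n rfl
    exact ⟨(kernelIsoOfEq (hd n) ≪≫ kernelCompMono (p (n + 1)) (i n) ≪≫
      (limit.isLimit _).conePointUniqueUpToIso (hE (n + 1)).fIsKernel).symm⟩
  simpa using key 0 (-1) (by simp)

end Resolution

section Syzygies

variable {𝒜 : Type*} [Category 𝒜] [Abelian 𝒜] [EnoughProjectives 𝒜] [EnoughInjectives 𝒜]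

/-- Iterated syzygies and cosyzygies of an object. -/
noncomputable def iteratedSyzygy (X : 𝒜) : List Bool → 𝒜
  | [] => X
  | true :: l => kernel (Projective.π (iteratedSyzygy X l))
  | false :: l => cokernel (Injective.ι (iteratedSyzygy X l))

lemma homExact_iteratedSyzygy {C : ChainComplex 𝒜 ℤ} (hI : ∀ n, Injective (C.X n))
    (hC : ∀ n, C.ExactAt n) (h : ∀ I, Injective I → HomExact I C) {X : 𝒜} (hX : HomExact X C) :
    ∀ l, HomExact (iteratedSyzygy X l) C
  | [] => hX
  | true :: l => HomExact.left (shortExact_of_kernel (Projective.π (iteratedSyzygy X l))) hI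
      (homExact_of_projective (inferInstanceAs (Projective (Projective.over _))) hC)
      (homExact_iteratedSyzygy hI hC h hX l)
  | false :: l => HomExact.right (shortExact_of_cokernel (Injective.ι (iteratedSyzygy X l))) hI
      (homExact_iteratedSyzygy hI hC h hX l) (h _ (inferInstanceAs (Injective (Injective.under _))))

end Syzygies

section Main

variable {𝒜 : Type*} [Category.{u} 𝒜] [Abelian 𝒜] [IsGrothendieckAbelian.{u} 𝒜]
  [EnoughProjectives 𝒜]

open IsGrothendieckAbelian

variable {ι : Type u}

/-- A set of objects, containing the members of a given family and a projective separator, and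
closed under syzygies and cosyzygies. -/
noncomputable def syzygyFamily (S : ι → 𝒜) (k : Option ι × List Bool) : 𝒜 :=
  iteratedSyzygy (k.1.elim (Projective.over (separator 𝒜)) S) k.2

lemma IsGorensteinInjective.ext1Zero_syzygyFamily {S : ι → 𝒜} (hS : ∀ i, Injective (S i)) {G : 𝒜}
    (hG : IsGorensteinInjective G) : ∀ k, Ext1Zero (syzygyFamily S k) G
  | (none, l) => hG.ext1Zero fun _ hI hC hH ↦ homExact_iteratedSyzygy hI hC hH
    (homExact_of_projective (inferInstanceAs (Projective (Projective.over (separator 𝒜)))) hC) l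
  | (some i, l) => hG.ext1Zero fun _ hI hC hH ↦ homExact_iteratedSyzygy hI hC hH (hH _ (hS i)) l

lemma ext1Zero_syzygyFamily_of_shortExact {S : ι → 𝒜} {T : ShortComplex 𝒜} (hT : T.ShortExact)
    (hI : Injective T.X₂) (h : ∀ k, Ext1Zero (syzygyFamily S k) T.X₁) (k : Option ι × List Bool) :
    Ext1Zero (syzygyFamily S k) T.X₃ := by
  have hK := shortExact_of_kernel (Projective.π (syzygyFamily S k))
  refine ext1Zero_of_exists_extend hK (inferInstanceAs (Projective (Projective.over _)))
    fun f ↦ ?_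
  obtain ⟨g, hg⟩ : ∃ g : kernel (Projective.π (syzygyFamily S k)) ⟶ T.X₂, g ≫ T.g = f :=
    (h (k.1, true :: k.2)).exists_lift hT f
  obtain ⟨m, hm⟩ : ∃ m, kernel.ι (Projective.π (syzygyFamily S k)) ≫ m = g :=
    ⟨_, Injective.comp_factorThru (J := T.X₂) g _⟩
  exact ⟨m ≫ T.g, (Category.assoc _ _ _).symm.trans ((hm =≫ T.g).trans hg)⟩

/-- The injectives are tested by the maps out of a family of injectives. -/
def InjectiveLiftingFamily (S : ι → 𝒜) : Prop :=
  (∀ i, Injective (S i)) ∧ ∀ ⦃E G : 𝒜⦄ (π : E ⟶ G),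
    (∀ i (f : S i ⟶ G), ∃ g, g ≫ π = f) → ∀ J, Injective J → ∀ f : J ⟶ G, ∃ g, g ≫ π = f

variable {S : ι → 𝒜}

lemma exists_injective_precover (hS : InjectiveLiftingFamily S)
    (hsum : ∀ {κ : Type u} (E : κ → 𝒜), (∀ k, Injective (E k)) → Injective (∐ E)) {G : 𝒜}
    (hG : ∀ k, Ext1Zero (syzygyFamily S k) G) :
    ∃ T : ShortComplex 𝒜, T.ShortExact ∧ Injective T.X₂ ∧
      (∀ k, Ext1Zero (syzygyFamily S k) T.X₁) ∧ T.X₃ = G := by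
  let E : 𝒜 := ∐ fun x : Σ i, S i ⟶ G ↦ S x.1
  let π : E ⟶ G := Sigma.desc fun x ↦ x.2
  have hE : Injective E := hsum _ fun x ↦ hS.1 x.1
  have hπ (J : 𝒜) (hJ : Injective J) (f : J ⟶ G) : ∃ g, g ≫ π = f :=
    hS.2 π (fun i f ↦ ⟨Sigma.ι (fun x : Σ i, S i ⟶ G ↦ S x.1) ⟨i, f⟩, by simp [π]⟩) J hJ f
  have hlift (k) (f : syzygyFamily S k ⟶ G) : ∃ g, g ≫ π = f := by
    obtain ⟨f', hf'⟩ : ∃ f' : Injective.under (syzygyFamily S k) ⟶ G, Injective.ι _ ≫ f' = f :=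
      Ext1Zero.exists_extend (shortExact_of_cokernel (Injective.ι _)) (hG (k.1, false :: k.2)) f
    obtain ⟨g, hg⟩ := hπ _ inferInstance f'
    exact ⟨Injective.ι _ ≫ g, by rw [Category.assoc, hg, hf']⟩
  have := epi_of_lift_separator π (hlift (none, []))
  have hT := shortExact_of_kernel π
  exact ⟨_, hT, hE, fun k ↦ (ext1Zero_iff_exists_lift hT hE).2 (hlift k), rfl⟩

lemma ext1Zero_of_injective_of_syzygyFamily (hS : InjectiveLiftingFamily S) {G : 𝒜}
    (hG : ∀ k, Ext1Zero (syzygyFamily S k) G) {J : 𝒜} (hJ : Injective J) : Ext1Zero J G := by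
  have hT := shortExact_of_cokernel (Injective.ι G)
  exact (ext1Zero_iff_exists_lift hT (inferInstanceAs (Injective (Injective.under G)))).2
    (hS.2 _ (fun i ↦ (hG (some i, [])).exists_lift hT) J hJ)

theorem isGorensteinInjective_iff_ext1Zero_syzygyFamily (hS : InjectiveLiftingFamily S)
    (hsum : ∀ {κ : Type u} (E : κ → 𝒜), (∀ k, Injective (E k)) → Injective (∐ E)) (G : 𝒜) :
    IsGorensteinInjective G ↔ ∀ k, Ext1Zero (syzygyFamily S k) G := by
  refine ⟨fun h ↦ h.ext1Zero_syzygyFamily hS.1, fun h ↦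
    isGorensteinInjective_of_class (𝒢 := fun G ↦ ∀ k, Ext1Zero (syzygyFamily S k) G)
      (fun G hG ↦ exists_injective_precover hS hsum hG) (fun G hG ↦ ?_)
      (fun G hG I hI ↦ ext1Zero_of_injective_of_syzygyFamily hS hG hI) h⟩
  have hT := shortExact_of_cokernel (Injective.ι G)
  have hI : Injective (Injective.under G) := inferInstance
  exact ⟨_, hT, hI, ext1Zero_syzygyFamily_of_shortExact hT hI hG, rfl⟩

theorem gorensteinInjective_complete_hereditary_cotorsion_pair (hS : InjectiveLiftingFamily S)
    (hsum : ∀ {κ : Type u} (E : κ → 𝒜), (∀ k, Injective (E k)) → Injective (∐ E)) :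
    (∀ Y : 𝒜, IsGorensteinInjective Y ↔
      rightOrthogonal (leftOrthogonal (fun K : 𝒜 ↦ IsGorensteinInjective K)) Y) ∧
    (∀ X : 𝒜,
      (∃ (Y L : 𝒜) (i : Y ⟶ L) (p : L ⟶ X) (w : i ≫ p = 0), (ShortComplex.mk i p w).ShortExact ∧
          leftOrthogonal (fun K : 𝒜 ↦ IsGorensteinInjective K) L ∧ IsGorensteinInjective Y) ∧
      (∃ (Y' L' : 𝒜) (i : X ⟶ Y') (p : Y' ⟶ L') (w : i ≫ p = 0),
        (ShortComplex.mk i p w).ShortExact ∧ IsGorensteinInjective Y' ∧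
          leftOrthogonal (fun K : 𝒜 ↦ IsGorensteinInjective K) L')) ∧
    (∀ L : 𝒜, leftOrthogonal (fun K : 𝒜 ↦ IsGorensteinInjective K) L →
      ∀ Y : 𝒜, IsGorensteinInjective Y → ∀ n : ℕ, ExtSucZero n L Y) := by
  simp_rw [isGorensteinInjective_iff_ext1Zero_syzygyFamily hS hsum]
  refine ⟨fun Y ↦ ⟨fun h L hL ↦ hL Y h, fun h k ↦ h _ fun Z hZ ↦ hZ k⟩, fun X ↦ ?_,
    fun L hL Y hY n ↦ ?_⟩
  · obtain ⟨h, h'⟩ := exists_shortExact_leftOrthogonal (syzygyFamily S) X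
    constructor
    · obtain ⟨T, hT, rfl, h₂, h₁⟩ := h
      exact ⟨_, _, T.f, T.g, T.zero, hT, h₂, h₁⟩
    · obtain ⟨T, hT, rfl, h₂, h₃⟩ := h'
      exact ⟨_, _, T.f, T.g, T.zero, hT, h₂, h₃⟩
  · induction n generalizing Y with
    | zero => exact hL Y hY
    | succ n ih =>
      exact fun E Y' i p w hE hI ↦ ih Y' (ext1Zero_syzygyFamily_of_shortExact hE hI hY)

end Main

section Contraction

variable {𝒞 : Type*} [Category 𝒞] [Abelian 𝒞]

/-- A contraction of a chain complex. -/
structure Contraction (K : ChainComplex 𝒞 ℤ) where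
  /-- The homotopy; only the components that raise the degree by one matter. -/
  σ (i j : ℤ) : K.X i ⟶ K.X j
  eq {i j k : ℤ} (hi : j + 1 = i) (hk : k + 1 = j) :
    K.d j k ≫ σ k j + σ j i ≫ K.d i j = 𝟙 (K.X j)

namespace Contraction

variable {K : ChainComplex 𝒞 ℤ}

lemma exists_lift (c : Contraction K) {E G : ChainComplex 𝒞 ℤ} (π : E ⟶ G) (f : K ⟶ G)
    (g : ∀ n, K.X n ⟶ E.X n) (hg : ∀ n, g n ≫ π.f n = f.f n) : ∃ F : K ⟶ E, F ≫ π = f := by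
  refine ⟨Homotopy.nullHomotopicMap fun i j ↦ c.σ i j ≫ g j, ?_⟩
  ext n
  have h₁ : (ComplexShape.down ℤ).Rel (n + 1) n := rfl
  have h₂ : (ComplexShape.down ℤ).Rel n (n - 1) := by simp
  rw [HomologicalComplex.comp_f, Homotopy.nullHomotopicMap_f h₁ h₂]
  have := c.eq (i := n + 1) (j := n) (k := n - 1) rfl (by simp)
  simp only [Preadditive.add_comp, Category.assoc, hg, ← π.comm, reassoc_of% hg]
  rw [f.comm, ← Category.assoc, ← Category.assoc, ← Preadditive.add_comp, this, Category.id_comp]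

lemma exists_extend (c : Contraction K) {A B : ChainComplex 𝒞 ℤ} (m : A ⟶ B) (f : A ⟶ K)
    (g : ∀ n, B.X n ⟶ K.X n) (hg : ∀ n, m.f n ≫ g n = f.f n) : ∃ F : B ⟶ K, m ≫ F = f := by
  refine ⟨Homotopy.nullHomotopicMap fun i j ↦ g i ≫ c.σ i j, ?_⟩
  ext n
  have h₁ : (ComplexShape.down ℤ).Rel (n + 1) n := rfl
  have h₂ : (ComplexShape.down ℤ).Rel n (n - 1) := by simp
  rw [HomologicalComplex.comp_f, Homotopy.nullHomotopicMap_f h₁ h₂]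
  have := c.eq (i := n + 1) (j := n) (k := n - 1) rfl (by simp)
  simp only [Preadditive.comp_add, Category.assoc, reassoc_of% hg, m.comm_assoc]
  rw [← f.comm_assoc, ← Preadditive.comp_add, this, Category.comp_id]

lemma injective (c : Contraction K) (hK : ∀ n, Injective (K.X n)) : Injective K where
  factors f m _ := c.exists_extend m f
    (fun n ↦ Injective.factorThru (f.f n) (m.f n))
    fun _ ↦ Injective.comp_factorThru _ _

lemma nonempty_of_injective (hK : Injective K) : Nonempty (Contraction K) := by
  classical
  let i := HomologicalComplex.homotopyCofiber.inr (𝟙 K)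
  have (n : ℤ) : Mono (i.f n) := by
    have : Mono (i.f n ≫ HomologicalComplex.homotopyCofiber.sndX (𝟙 K) n) := by
      dsimp [i, HomologicalComplex.homotopyCofiber.inr]
      rw [HomologicalComplex.homotopyCofiber.inrX_sndX]
      infer_instance
    exact mono_of_mono _ (HomologicalComplex.homotopyCofiber.sndX (𝟙 K) n)
  have : Mono i := HomologicalComplex.mono_of_mono_f _ this
  let r := Injective.factorThru (𝟙 K) i
  have hr : i ≫ r = 𝟙 K := Injective.comp_factorThru _ _
  let H : Homotopy (𝟙 K) 0 := (Homotopy.ofEq (by simpa using hr.symm)).trans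
    (((HomologicalComplex.homotopyCofiber.inrCompHomotopy (𝟙 K)
      (fun j ↦ ⟨j + 1, rfl⟩)).compRight r).trans (Homotopy.ofEq zero_comp))
  refine ⟨H.hom, fun {i j k} hi hk ↦ ?_⟩
  have := H.comm j
  rw [dNext_eq _ (show (ComplexShape.down ℤ).Rel j k from hk),
    prevD_eq _ (show (ComplexShape.down ℤ).Rel i j from hi)] at this
  simpa using this.symm

end Contraction

section Disk

lemma down_rel_sub_one (n : ℤ) : (ComplexShape.down ℤ).Rel n (n - 1) := sub_add_cancel n 1

lemma ne_sub_one (n : ℤ) : n ≠ n - 1 := by lia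

/-- The complex `X = X` concentrated in degrees `n` and `n - 1`. -/
noncomputable def disk (n : ℤ) (X : 𝒞) : ChainComplex 𝒞 ℤ :=
  HomologicalComplex.double (𝟙 X) (down_rel_sub_one n)

/-- The upper nonzero component of a disk. -/
noncomputable def diskXIso₀ (n : ℤ) (X : 𝒞) : (disk n X).X n ≅ X :=
  HomologicalComplex.doubleXIso₀ _ _

/-- The lower nonzero component of a disk. -/
noncomputable def diskXIso₁ (n : ℤ) (X : 𝒞) : (disk n X).X (n - 1) ≅ X :=
  HomologicalComplex.doubleXIso₁ _ _ (ne_sub_one n)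

lemma isZero_disk_X {n k : ℤ} (X : 𝒞) (h₀ : k ≠ n) (h₁ : k ≠ n - 1) : IsZero ((disk n X).X k) :=
  HomologicalComplex.isZero_double_X _ _ _ h₀ h₁

lemma disk_d (n : ℤ) (X : 𝒞) :
    (disk n X).d n (n - 1) = (diskXIso₀ n X).hom ≫ (diskXIso₁ n X).inv :=
  (HomologicalComplex.double_d _ _ (ne_sub_one n)).trans (by rw [Category.id_comp]; rfl)

/-- Morphisms from a disk are morphisms into a component. -/
noncomputable def diskHomEquiv {n : ℤ} {X : 𝒞} {K : ChainComplex 𝒞 ℤ} :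
    (disk n X ⟶ K) ≃ (X ⟶ K.X n) :=
  (HomologicalComplex.evalCompCoyonedaCorepresentableByDoubleId
    (down_rel_sub_one n) (ne_sub_one n) X).homEquiv

lemma diskHomEquiv_apply {n : ℤ} {X : 𝒞} {K : ChainComplex 𝒞 ℤ} (f : disk n X ⟶ K) :
    diskHomEquiv f = (diskXIso₀ n X).inv ≫ f.f n :=
  rfl

lemma diskHomEquiv_comp {n : ℤ} {X : 𝒞} {K L : ChainComplex 𝒞 ℤ} (f : disk n X ⟶ K) (g : K ⟶ L) :
    diskHomEquiv (f ≫ g) = diskHomEquiv f ≫ g.f n := by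
  simp [diskHomEquiv_apply]

lemma projective_disk {P : 𝒞} (hP : Projective P) (n : ℤ) : Projective (disk n P) where
  factors f e he := by
    refine ⟨diskHomEquiv.symm (Projective.factorThru (diskHomEquiv f) (e.f n)), ?_⟩
    apply diskHomEquiv.injective
    rw [diskHomEquiv_comp, Equiv.apply_symm_apply, Projective.factorThru_comp]

/-- Disks are contractible. -/
noncomputable def diskContraction (n : ℤ) (X : 𝒞) : Contraction (disk n X) where
  σ i j := if h : i = n - 1 ∧ j = n then eqToHom (congrArg (disk n X).X h.1) ≫
    (diskXIso₁ n X).hom ≫ (diskXIso₀ n X).inv ≫ eqToHom (congrArg (disk n X).X h.2.symm) else 0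
  eq {i j k} hi hk := by
    by_cases h₀ : j = n
    · obtain rfl := h₀
      obtain rfl : k = j - 1 := by lia
      simp [disk_d, ne_sub_one]
    · by_cases h₁ : j = n - 1
      · obtain rfl := h₁
        obtain rfl : i = n := by lia
        have : (disk i X).d (i - 1) k = 0 :=
          HomologicalComplex.double_d_eq_zero₀ _ _ _ _ (ne_sub_one i).symm
        simp [disk_d, this]
      · exact (isZero_disk_X X h₀ h₁).eq_of_src _ _

lemma injective_disk {I : 𝒞} (hI : Injective I) (n : ℤ) : Injective (disk n I) := by
  refine (diskContraction n I).injective fun k ↦ ?_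
  by_cases h₀ : k = n
  · obtain rfl := h₀
    exact Injective.of_iso (diskXIso₀ _ _).symm hI
  · by_cases h₁ : k = n - 1
    · obtain rfl := h₁
      exact Injective.of_iso (diskXIso₁ _ _).symm hI
    · exact ⟨fun f i _ ↦ ⟨0, (isZero_disk_X I h₀ h₁).eq_of_tgt _ _⟩⟩

lemma mono_of_diskHomEquiv {A B : 𝒞} {n : ℤ} (M : disk n A ⟶ disk n B)
    (hM : Mono (diskHomEquiv M)) : Mono M := by
  rw [diskHomEquiv_apply] at hM
  have h₀ : Mono (M.f n) := by
    have := mono_comp (diskXIso₀ n A).hom ((diskXIso₀ n A).inv ≫ M.f n)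
    simpa using this
  refine HomologicalComplex.mono_of_mono_f _ fun k ↦ ?_
  by_cases h₀ : k = n
  · obtain rfl := h₀
    assumption
  · by_cases h₁ : k = n - 1
    · obtain rfl := h₁
      have (X : 𝒞) : IsIso ((disk n X).d n (n - 1)) := by rw [disk_d]; infer_instance
      have h := M.comm n (n - 1)
      have : Mono (M.f n ≫ (disk n B).d n (n - 1)) := mono_comp _ _
      rw [h] at this
      have := mono_comp (inv ((disk n A).d n (n - 1))) ((disk n A).d n (n - 1) ≫ M.f (n - 1))
      simpa using this
    · exact ⟨fun _ _ _ ↦ (isZero_disk_X A h₀ h₁).eq_of_tgt _ _⟩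

end Disk

lemma injective_X {K : ChainComplex 𝒞 ℤ} (hK : Injective K) (n : ℤ) : Injective (K.X n) where
  factors {A B} f m hm := by
    let M : disk n A ⟶ disk n B := diskHomEquiv.symm (m ≫ diskHomEquiv (𝟙 _))
    have hM : diskHomEquiv M = m ≫ diskHomEquiv (𝟙 _) := Equiv.apply_symm_apply _ _
    have : Mono M := mono_of_diskHomEquiv M (by
      rw [hM, diskHomEquiv_apply]
      exact mono_comp _ _)
    refine ⟨diskHomEquiv (Injective.factorThru (diskHomEquiv.symm f) M), ?_⟩
    have := congrArg diskHomEquiv (Injective.comp_factorThru (diskHomEquiv.symm f) M)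
    rwa [diskHomEquiv_comp, hM, Category.assoc, ← diskHomEquiv_comp, Category.id_comp,
      Equiv.apply_symm_apply] at this

lemma injective_iff_contraction {K : ChainComplex 𝒞 ℤ} :
    Injective K ↔ (∀ n, Injective (K.X n)) ∧ Nonempty (Contraction K) :=
  ⟨fun h ↦ ⟨injective_X h, Contraction.nonempty_of_injective h⟩, fun ⟨h, ⟨c⟩⟩ ↦ c.injective h⟩

end Contraction

lemma InjectiveLiftingFamily.chainComplex {𝒞 : Type*} [Category.{u} 𝒞] [Abelian 𝒞]
    {ι : Type u} {s : ι → 𝒞}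
    (hs : InjectiveLiftingFamily s) :
    InjectiveLiftingFamily fun x : ULift.{u} ℤ × ι ↦ disk x.1.down (s x.2) := by
  refine ⟨fun x ↦ injective_disk (hs.1 _) _, fun E G π h J hJ f ↦ ?_⟩
  obtain ⟨hJ', ⟨c⟩⟩ := injective_iff_contraction.1 hJ
  choose g hg using fun n ↦ hs.2 (π.f n) (fun i f ↦ by
    obtain ⟨g, hg⟩ := h (⟨n⟩, i) (diskHomEquiv.symm f)
    exact ⟨diskHomEquiv g, by rw [← diskHomEquiv_comp, hg, Equiv.apply_symm_apply]⟩)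
    (J.X n) (hJ' n) (f.f n)
  exact c.exists_lift π f g hg

section Grothendieck

variable {𝒞 : Type*} [Category.{u} 𝒞] [Abelian 𝒞] [IsGrothendieckAbelian.{u} 𝒞]

instance enoughProjectives_chainComplex [EnoughProjectives 𝒞] : EnoughProjectives (ChainComplex 𝒞 ℤ) where
  presentation K := by
    let D (n : ULift.{u} ℤ) : ChainComplex 𝒞 ℤ := disk n.down (Projective.over (K.X n.down))
    have hD (n) : Projective (D n) := projective_disk inferInstance _
    have : Projective (∐ D) := ⟨fun f e _ ↦ ⟨Sigma.desc fun n ↦ Projective.factorThru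
      (Sigma.ι D n ≫ f) e, Sigma.hom_ext _ _ fun n ↦ by simp⟩⟩
    let φ : ∐ D ⟶ K := Sigma.desc fun n ↦ diskHomEquiv.symm (Projective.π (K.X n.down))
    have : Epi φ := HomologicalComplex.epi_of_epi_f _ fun n ↦ by
      have h : diskHomEquiv (Sigma.ι D ⟨n⟩) ≫ φ.f n = Projective.π _ := by
        rw [← diskHomEquiv_comp]
        simp [φ]
      have : Epi (diskHomEquiv (Sigma.ι D ⟨n⟩) ≫ φ.f n) := by rw [h]; infer_instance
      exact epi_of_epi (diskHomEquiv (Sigma.ι D ⟨n⟩)) _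
    exact ⟨{ p := ∐ D, f := φ }⟩

lemma injective_sigma_chainComplex
    (hsum : ∀ {κ : Type u} (E : κ → 𝒞), (∀ k, Injective (E k)) → Injective (∐ E))
    {κ : Type u} (E : κ → ChainComplex 𝒞 ℤ) (hE : ∀ k, Injective (E k)) : Injective (∐ E) := by
  let ev (n : ℤ) := HomologicalComplex.eval 𝒞 (ComplexShape.down ℤ) n
  let hev (n : ℤ) := isColimitOfHasCoproductOfPreservesColimit (ev n) E
  let c (k : κ) : Contraction (E k) := (injective_iff_contraction.1 (hE k)).2.some
  let σ (i j : ℤ) : (∐ E).X i ⟶ (∐ E).X j :=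
    Cofan.IsColimit.desc (hev i) fun k ↦ (c k).σ i j ≫ (Sigma.ι E k).f j
  have hσ (i j : ℤ) (k : κ) : (Sigma.ι E k).f i ≫ σ i j = (c k).σ i j ≫ (Sigma.ι E k).f j :=
    Cofan.IsColimit.fac (hev i) _ _
  refine injective_iff_contraction.2 ⟨fun n ↦ ?_, ⟨σ, fun {i j k} hi hk ↦ ?_⟩⟩
  · exact Injective.of_iso ((colimit.isColimit _).coconePointUniqueUpToIso (hev n))
      (hsum (fun k ↦ (E k).X n) fun k ↦ injective_X (hE k) n)
  · refine Cofan.IsColimit.hom_ext (hev j) _ _ fun a ↦ ?_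
    change (Sigma.ι E a).f j ≫ _ = (Sigma.ι E a).f j ≫ _
    rw [Preadditive.comp_add, HomologicalComplex.Hom.comm_assoc, hσ, reassoc_of% hσ,
      HomologicalComplex.Hom.comm, ← Category.assoc, ← Category.assoc, ← Preadditive.add_comp,
      (c a).eq hi hk, Category.id_comp, Category.comp_id]

end Grothendieck

section Lattice

lemma exists_le_maximal_disjoint {α : Type*} [CompleteLattice α] [IsCompactlyGenerated α]
    {a b : α} (h : Disjoint a b) : ∃ c, b ≤ c ∧ Maximal (Disjoint a) c := by
  refine zorn_le_nonempty₀ {c | Disjoint a c} (fun s hs hc x hx ↦ ?_) b h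
  refine ⟨sSup s, ?_, fun z hz ↦ le_sSup hz⟩
  exact hc.directedOn.disjoint_sSup_right.2 fun z hz ↦ hs hz

end Lattice

namespace Module.Baer

variable {R : Type u} [Ring R]

section

variable {M N : Type*} [AddCommGroup M] [Module R M] [AddCommGroup N] [Module R N]

lemma of_retract (h : Module.Baer R M) (i : N →ₗ[R] M) (p : M →ₗ[R] N)
    (hpi : ∀ x, p (i x) = x) : Module.Baer R N := by
  intro I g
  obtain ⟨g', hg'⟩ := h I (i ∘ₗ g)
  exact ⟨p ∘ₗ g', fun x hx ↦ by simp [hg' x hx, hpi]⟩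

lemma prod (hM : Module.Baer R M) (hN : Module.Baer R N) : Module.Baer R (M × N) := by
  intro I g
  obtain ⟨a, ha⟩ := hM I (LinearMap.fst R M N ∘ₗ g)
  obtain ⟨b, hb⟩ := hN I (LinearMap.snd R M N ∘ₗ g)
  exact ⟨a.prod b, fun x hx ↦ by simp [ha x hx, hb x hx]⟩

lemma exists_projection {A : Submodule R M} (hA : Module.Baer R A) :
    ∃ p : M →ₗ[R] A, ∀ x : A, p x = x := by
  obtain ⟨p, hp⟩ := hA.extension_property A.subtype A.subtype_injective LinearMap.id
  exact ⟨p, fun x ↦ LinearMap.congr_fun hp x⟩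

lemma ker_of_projection (h : Module.Baer R M) {A : Submodule R M} (p : M →ₗ[R] A)
    (hp : ∀ x : A, p x = x) : Module.Baer R (LinearMap.ker p) :=
  h.of_retract (LinearMap.ker p).subtype
    ((LinearMap.id - A.subtype ∘ₗ p).codRestrict _ fun x ↦ by simp [hp])
    fun x ↦ by ext; simp [LinearMap.mem_ker.1 x.2]

lemma sup_of_disjoint {A B : Submodule R M} (hA : Module.Baer R A) (hB : Module.Baer R B)
    (h : Disjoint A B) : Module.Baer R (A ⊔ B : Submodule R M) := by
  have hinj : Function.Injective (A.subtype.coprod B.subtype) := by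
    rw [← LinearMap.ker_eq_bot, LinearMap.ker_coprod_of_disjoint_range _ _ (by simpa using h)]
    simp
  refine of_equiv ?_ (hA.prod hB)
  exact (LinearEquiv.ofInjective _ hinj).trans
    (LinearEquiv.ofEq _ _ (by simp [LinearMap.range_coprod]))

variable [IsNoetherianRing R]

lemma sSup_of_directed {s : Set (Submodule R M)} (hne : s.Nonempty) (hs : DirectedOn (· ≤ ·) s)
    (h : ∀ A ∈ s, Module.Baer R A) : Module.Baer R (sSup s : Submodule R M) := by
  intro I g
  have hfg : (LinearMap.range ((sSup s).subtype ∘ₗ g)).FG := by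
    rw [LinearMap.range_eq_map]
    exact (Module.finite_def.1 inferInstance : (⊤ : Submodule R I).FG).map _
  obtain ⟨A, hA, hle⟩ := (Submodule.fg_iff_compact _).1 hfg s _ hne hs (isLUB_sSup s)
    (by rintro _ ⟨x, rfl⟩; exact (g x).2)
  obtain ⟨g', hg'⟩ := h A hA I
    (((sSup s).subtype ∘ₗ g).codRestrict A fun x ↦ hle ⟨x, rfl⟩)
  exact ⟨Submodule.inclusion (le_sSup hA) ∘ₗ g', fun x hx ↦ Subtype.ext <| by simp [hg' x hx]⟩

lemma dfinsupp {ι : Type*} {M : ι → Type*} [∀ i, AddCommGroup (M i)] [∀ i, Module R (M i)]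
    (h : ∀ i, Module.Baer R (M i)) : Module.Baer R (Π₀ i, M i) := by
  classical
  intro I g
  obtain ⟨t, ht⟩ := (Module.finite_def.1 inferInstance : (⊤ : Submodule R I).FG)
  choose e he using fun i ↦ h i I (DFinsupp.lapply i ∘ₗ g)
  have hsupp : ∀ (x : I) (j : ι), j ∉ t.biUnion (fun y ↦ (g y).support) → g x j = 0 := by
    intro x j hj
    have hle : (⊤ : Submodule R I) ≤ LinearMap.ker (DFinsupp.lapply j ∘ₗ g) := by
      rw [← ht, Submodule.span_le]
      intro y hy
      by_contra hne
      exact hj (Finset.mem_biUnion.2 ⟨y, hy, DFinsupp.mem_support_toFun _ _ |>.2 hne⟩)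
    exact hle (Submodule.mem_top (x := x))
  refine ⟨∑ i ∈ t.biUnion (fun y ↦ (g y).support), DFinsupp.lsingle i ∘ₗ e i, fun x hx ↦ ?_⟩
  ext j
  simp only [LinearMap.sum_apply, LinearMap.comp_apply, DFinsupp.finsetSum_apply,
    DFinsupp.lsingle_apply]
  by_cases hj : j ∈ t.biUnion (fun y ↦ (g y).support)
  · rw [Finset.sum_eq_single_of_mem j hj fun i _ hij ↦ DFinsupp.single_eq_of_ne hij.symm]
    simpa using he j x hx
  · rw [Finset.sum_eq_zero fun i hi ↦ DFinsupp.single_eq_of_ne (by rintro rfl; exact hj hi),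
      hsupp _ _ hj]

end

section Hull

lemma exists_injective_hull (Q : Type u) [AddCommGroup Q] [Module R Q] :
    ∃ (E : ModuleCat.{u} R) (i : Q →ₗ[R] E), Module.Baer R E ∧ Function.Injective i ∧
      ∀ B : Submodule R E, Disjoint (LinearMap.range i) B → B = ⊥ := by
  obtain ⟨⟨J, hJ, i, hi⟩⟩ := EnoughInjectives.presentation (ModuleCat.of R Q)
  have hJ' : Module.Baer R J := Module.Baer.iff_injective.2
    ((Module.injective_iff_injective_object R J).2 hJ)
  obtain ⟨C, -, hC⟩ := exists_le_maximal_disjoint (disjoint_bot_right (a := LinearMap.range i.hom))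
  obtain ⟨A, hQA, hA⟩ := exists_le_maximal_disjoint hC.prop.symm
  have hmax : ∀ D, C ≤ D → Disjoint A D → D = C := fun D hCD hAD ↦
    le_antisymm (hC.le_of_ge (hAD.mono_left hQA) hCD) hCD
  have hinj : Function.Injective (C.mkQ ∘ₗ A.subtype) := by
    rw [← LinearMap.ker_eq_bot, LinearMap.ker_comp, Submodule.ker_mkQ, eq_bot_iff]
    exact fun a ha ↦ Subtype.ext (Submodule.disjoint_def.1 hA.prop a ha a.2)
  obtain ⟨φ, hφ⟩ := hJ'.extension_property _ hinj A.subtype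
  let p : J →ₗ[R] J := φ ∘ₗ C.mkQ
  have hpA : ∀ a ∈ A, p a = a := fun a ha ↦ LinearMap.congr_fun hφ ⟨a, ha⟩
  have hpC : ∀ c ∈ C, p c = 0 := fun c hc ↦ by
    simp [p, (Submodule.Quotient.mk_eq_zero C).2 hc]
  have hcomap : C.comap p = C := by
    refine hmax _ (fun c hc ↦ by simp [hpC c hc]) ?_
    rw [Submodule.disjoint_def]
    intro a ha hac
    rw [Submodule.mem_comap, hpA a ha] at hac
    exact (Submodule.disjoint_def.1 hA.prop) a hac ha
  have hrange : LinearMap.range p ≤ A := by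
    refine hA.le_of_ge ?_ fun a ha ↦ ⟨a, hpA a ha⟩
    rw [Submodule.disjoint_def]
    rintro _ hc ⟨x, rfl⟩
    exact hpC x (hcomap.le hc)
  have hi' : Function.Injective i.hom := (ModuleCat.mono_iff_injective i).1 hi
  refine ⟨ModuleCat.of R A, i.hom.codRestrict A fun x ↦ hQA ⟨x, rfl⟩,
    hJ'.of_retract A.subtype (p.codRestrict A fun x ↦ hrange ⟨x, rfl⟩)
      fun x ↦ Subtype.ext (hpA x x.2), fun x y hxy ↦ hi' (congrArg Subtype.val hxy), ?_⟩
  intro B hB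
  rw [Submodule.disjoint_def] at hB
  let B' : Submodule R J := Submodule.map A.subtype B
  have hdisj : Disjoint (LinearMap.range i.hom) (C ⊔ B') := by
    rw [Submodule.disjoint_def]
    rintro _ ⟨x, rfl⟩ hx
    obtain ⟨c, hc, _, ⟨b, hb, rfl⟩, hcb⟩ := Submodule.mem_sup.1 hx
    have hxb : i.hom x = b := by
      have h0 := Submodule.disjoint_def.1 hA.prop c hc (by
        rw [eq_sub_of_add_eq hcb]
        exact A.sub_mem (hQA ⟨x, rfl⟩) b.2)
      rw [← hcb, h0, zero_add]
      rfl
    have hb0 : b = 0 := hB b ⟨x, Subtype.ext hxb⟩ hb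
    rw [hxb, hb0]
    rfl
  rw [eq_bot_iff]
  intro b hb
  exact Subtype.ext (Submodule.disjoint_def.1 hA.prop b
    ((le_sup_right.trans (hC.le_of_ge hdisj le_sup_left)) ⟨b, hb, rfl⟩) b.2)

end Hull

end Module.Baer

namespace ModuleCat

variable (R : Type u) [Ring R]

/-- An injective hull of the cyclic module `R ⧸ a`. -/
noncomputable def cyclicHull (a : Ideal R) : ModuleCat.{u} R :=
  (Module.Baer.exists_injective_hull (R := R) (R ⧸ a)).choose

variable {R}

lemma exists_essential_cyclicHull (a : Ideal R) :
    ∃ i : (R ⧸ a) →ₗ[R] cyclicHull R a, Module.Baer R (cyclicHull R a) ∧ Function.Injective i ∧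
      ∀ B : Submodule R (cyclicHull R a), Disjoint (LinearMap.range i) B → B = ⊥ :=
  (Module.Baer.exists_injective_hull (R := R) (R ⧸ a)).choose_spec

lemma baer_cyclicHull (a : Ideal R) : Module.Baer R (cyclicHull R a) :=
  (exists_essential_cyclicHull a).choose_spec.1

/-- A nonzero injective module contains the injective hull of a nonzero cyclic module. -/
lemma exists_injective_from_cyclicHull {J : Type u} [AddCommGroup J] [Module R J]
    (hJ : Module.Baer R J) {x : J} (hx : x ≠ 0) :
    ∃ (a : Ideal R) (f : cyclicHull R a →ₗ[R] J), Function.Injective f ∧ f ≠ 0 := by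
  let a : Ideal R := LinearMap.ker (LinearMap.toSpanSingleton R J x)
  obtain ⟨i, -, hi, hess⟩ := exists_essential_cyclicHull a
  let j : (R ⧸ a) →ₗ[R] J := Submodule.liftQ a (LinearMap.toSpanSingleton R J x) le_rfl
  have hj : Function.Injective j :=
    LinearMap.ker_eq_bot.1 (Submodule.ker_liftQ_eq_bot' a _ rfl)
  obtain ⟨f, hf⟩ := hJ.extension_property i hi j
  refine ⟨a, f, LinearMap.ker_eq_bot.1 (hess _ ?_), ?_⟩
  · rw [Submodule.disjoint_def]
    rintro _ ⟨y, rfl⟩ hy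
    rw [LinearMap.mem_ker, ← LinearMap.comp_apply, hf] at hy
    rw [hj (hy.trans (map_zero j).symm), map_zero]
  · rintro rfl
    have h1 := LinearMap.congr_fun hf (Submodule.Quotient.mk 1)
    have h2 : j (Submodule.Quotient.mk 1) = x := by
      simp only [j, Submodule.liftQ_apply, LinearMap.toSpanSingleton_apply, one_smul]
    exact hx (h2.symm.trans (h1.symm.trans (by simp)))

variable [IsNoetherianRing R]

lemma exists_lift_of_cyclicHull {J E G : Type u} [AddCommGroup J] [Module R J] [AddCommGroup E]
    [Module R E] [AddCommGroup G] [Module R G] (hJ : Module.Baer R J) (π : E →ₗ[R] G)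
    (h : ∀ (a : Ideal R) (k : cyclicHull R a →ₗ[R] G), ∃ g, π ∘ₗ g = k) (f : J →ₗ[R] G) :
    ∃ g : J →ₗ[R] E, π ∘ₗ g = f := by
  let S : Set (J →ₗ.[R] E) := {p | Module.Baer R p.domain ∧ ∀ x : p.domain, π (p x) = f x}
  obtain ⟨p, -, hp⟩ := zorn_le_nonempty₀ S (by
    intro c hcS hc p₀ hp₀
    have hd := hc.directedOn
    refine ⟨LinearPMap.sSup c hd, ⟨?_, ?_⟩, fun z hz ↦ LinearPMap.le_sSup hd hz⟩
    · refine Module.Baer.sSup_of_directed (Set.Nonempty.image _ ⟨p₀, hp₀⟩)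
        (directedOn_image.2 (hd.mono fun _ _ h ↦ h.1)) ?_
      rintro _ ⟨q, hq, rfl⟩
      exact (hcS hq).1
    · rintro ⟨x, hx⟩
      obtain ⟨q, hq, hxq⟩ := (LinearPMap.mem_domain_sSup_iff ⟨p₀, hp₀⟩ hd).1 hx
      exact (congrArg π (LinearPMap.sSup_apply hd hq ⟨x, hxq⟩)).trans ((hcS hq).2 ⟨x, hxq⟩))
    ⊥ ⟨by
      intro I g
      refine ⟨0, fun x hx ↦ ?_⟩
      exact Subsingleton.elim (α := (⊥ : Submodule R J)) _ _, by
      rintro ⟨x, hx⟩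
      obtain rfl := (Submodule.mem_bot R).1 hx
      change π ((⊥ : J →ₗ.[R] E) 0) = f 0
      simp⟩
  obtain ⟨q, hq⟩ := hp.prop.1.exists_projection
  have hker : ∀ x ∈ LinearMap.ker q, x = 0 := by
    intro x hx
    by_contra hne
    obtain ⟨a, j, hj, hj0⟩ := exists_injective_from_cyclicHull (hJ.ker_of_projection q hq)
      (x := ⟨x, hx⟩) (fun h0 ↦ hne (congrArg Subtype.val h0))
    let j' := (LinearMap.ker q).subtype ∘ₗ j
    have hj' : Function.Injective j' := (LinearMap.ker q).subtype_injective.comp hj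
    obtain ⟨k, hk⟩ := h a (f ∘ₗ j')
    let e := LinearEquiv.ofInjective j' hj'
    let r : J →ₗ.[R] E := ⟨LinearMap.range j', k ∘ₗ e.symm.toLinearMap⟩
    have hr : ∀ y : r.domain, π (r y) = f y := by
      intro y
      obtain ⟨y, rfl⟩ := e.surjective y
      have := LinearMap.congr_fun hk y
      change π (k (e.symm (e y))) = f (j' y)
      simpa using this
    have hdisj : Disjoint p.domain r.domain := by
      rw [Submodule.disjoint_def]
      rintro y hy ⟨z, rfl⟩
      have h1 := hq ⟨_, hy⟩
      rw [show q (j' z) = 0 from (j z).2] at h1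
      exact (congrArg Subtype.val h1).symm
    have hH := LinearPMap.sup_h_of_disjoint p r hdisj
    have hmem : p.sup r hH ∈ S := by
      refine ⟨hp.prop.1.sup_of_disjoint ((baer_cyclicHull a).of_equiv e) hdisj, ?_⟩
      rintro ⟨z, hz⟩
      obtain ⟨y, hy, w, hw, rfl⟩ := Submodule.mem_sup.1 hz
      refine (congrArg π (LinearPMap.sup_apply hH ⟨y, hy⟩ ⟨w, hw⟩ ⟨_, hz⟩ rfl)).trans ?_
      rw [map_add, hp.prop.2, hr, ← map_add]
    have hle := hp.le_of_ge hmem (p.left_le_sup r hH)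
    have hrp : r.domain ≤ p.domain := le_sup_right.trans hle.1
    refine hj0 (LinearMap.ext fun y ↦ Subtype.ext ?_)
    exact Submodule.disjoint_def.1 hdisj (j' y) (hrp ⟨y, rfl⟩) ⟨y, rfl⟩
  refine ⟨p.toFun ∘ₗ q, LinearMap.ext fun x ↦ ?_⟩
  have hx : x - q x = 0 := hker _ (by simp [hq])
  exact (hp.prop.2 (q x)).trans (congrArg f (sub_eq_zero.1 hx).symm)

theorem injectiveLiftingFamily_cyclicHull :
    InjectiveLiftingFamily (cyclicHull R) := by
  refine ⟨fun a ↦ (Module.injective_iff_injective_object R _).1 (baer_cyclicHull a).injective,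
    fun E G π h J hJ f ↦ ?_⟩
  have hJ' : Module.Baer R J := Module.Baer.iff_injective.2
    ((Module.injective_iff_injective_object R J).2 hJ)
  obtain ⟨g, hg⟩ := exists_lift_of_cyclicHull hJ' π.hom (fun a k ↦ by
    obtain ⟨g, hg⟩ := h a (ModuleCat.ofHom k)
    exact ⟨g.hom, congrArg ModuleCat.Hom.hom hg⟩) f.hom
  exact ⟨ModuleCat.ofHom g, ModuleCat.hom_ext hg⟩

theorem injective_sigma {κ : Type u} (E : κ → ModuleCat.{u} R) (hE : ∀ k, Injective (E k)) :
    Injective (∐ E) := by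
  classical
  refine Injective.of_iso (coprodIsoDirectSum E).symm
    ((Module.injective_iff_injective_object R _).1 (Module.Baer.injective ?_))
  exact Module.Baer.dfinsupp fun k ↦ Module.Baer.iff_injective.2
    ((Module.injective_iff_injective_object R (E k)).2 (hE k))

end ModuleCat

/-- Let `R` be a left noetherian ring and `GI(C)` the class of Gorenstein
injective complexes in `Ch(R)`.  Then `(⊥GI(C), GI(C))` is a complete hereditary cotorsion
pair in `Ch(R)`. -/
theorem leftOrth_gorensteinInjective_complexes_complete_hereditary_cotorsion_pair
    (R : Type u) [Ring R] [IsNoetherianRing R] :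
    -- `(⊥GI(C), GI(C))` is a cotorsion pair: `GI(C) = (⊥GI(C))⊥`
    (∀ Y : ChainComplex (ModuleCat.{u} R) ℤ, IsGorensteinInjective Y ↔
        rightOrthogonal (leftOrthogonal (fun K : ChainComplex (ModuleCat.{u} R) ℤ => IsGorensteinInjective K)) Y) ∧
    -- completeness
    (∀ X : ChainComplex (ModuleCat.{u} R) ℤ,
      (∃ (Y L : ChainComplex (ModuleCat.{u} R) ℤ) (i : Y ⟶ L) (p : L ⟶ X)
        (w : i ≫ p = 0), (ShortComplex.mk i p w).ShortExact ∧
          leftOrthogonal (fun K : ChainComplex (ModuleCat.{u} R) ℤ => IsGorensteinInjective K) L ∧ IsGorensteinInjective Y) ∧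
      (∃ (Y' L' : ChainComplex (ModuleCat.{u} R) ℤ) (i : X ⟶ Y') (p : Y' ⟶ L')
        (w : i ≫ p = 0), (ShortComplex.mk i p w).ShortExact ∧
          IsGorensteinInjective Y' ∧ leftOrthogonal (fun K : ChainComplex (ModuleCat.{u} R) ℤ => IsGorensteinInjective K) L')) ∧
    -- heredity: `Ext^i(L, Y) = 0` for all `i ≥ 1`
    (∀ L : ChainComplex (ModuleCat.{u} R) ℤ, leftOrthogonal (fun K : ChainComplex (ModuleCat.{u} R) ℤ => IsGorensteinInjective K) L →
      ∀ Y : ChainComplex (ModuleCat.{u} R) ℤ, IsGorensteinInjective Y →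
        ∀ n : ℕ, ExtSucZero n L Y) :=
  gorensteinInjective_complete_hereditary_cotorsion_pair
    ModuleCat.injectiveLiftingFamily_cyclicHull.chainComplex
    (injective_sigma_chainComplex ModuleCat.injective_sigma)
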